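/- If a (not necessarily bounded) sequence x in a normed vector space satisfies (1/n)∑_{i=0}^{n-1} x_{i+j} → v uniformly in j as n → ∞, then x is bounded. -/

import Mathlib

open Filter Topology

/-- If a (not necessarily bounded) sequence `x` in a normed vector space satisfies
`(1/n)∑_{i=0}^{n-1} x_{i+j} → v` uniformly in `j`, then `x` is bounded. -/
theorem stmt_17 {V : Type*} [NormedAddCommGroup V] [NormedSpace ℝ V]
    (x : ℕ → V) (v : V)
    (h : ∀ ε > (0 : ℝ), ∃ N : ℕ, ∀ n > N, ∀ j : ℕ,
      ‖(n : ℝ)⁻¹ • (∑ i ∈ Finset.range n, x (i + j)) - v‖ < ε) :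
    ∃ M : ℝ, ∀ n, ‖x n‖ ≤ M := by
  obtain ⟨N, hN⟩ := h 1 one_pos
  have key : ∀ n > N, ∀ j : ℕ,
      ‖∑ i ∈ Finset.range n, x (i + j)‖ ≤ (n : ℝ) * (1 + ‖v‖) := by
    intro n hn j
    have hpos : (0 : ℝ) < n := by exact_mod_cast (Nat.zero_le N).trans_lt hn
    have h1 := hN n hn j
    set S := ∑ i ∈ Finset.range n, x (i + j) with hS
    have h2 : ‖(n : ℝ)⁻¹ • S‖ ≤ 1 + ‖v‖ := by
      have h3 := norm_sub_norm_le ((n : ℝ)⁻¹ • S) v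
      linarith
    have h4 : S = (n : ℝ) • ((n : ℝ)⁻¹ • S) := by
      rw [smul_inv_smul₀ hpos.ne']
    rw [h4, norm_smul, Real.norm_of_nonneg hpos.le]
    exact mul_le_mul_of_nonneg_left h2 hpos.le
  refine ⟨((N + 2 : ℕ) : ℝ) * (1 + ‖v‖) + ((N + 1 : ℕ) : ℝ) * (1 + ‖v‖), fun j => ?_⟩
  have e : x j = (∑ i ∈ Finset.range (N + 2), x (i + j))
      - ∑ i ∈ Finset.range (N + 1), x (i + (j + 1)) := by
    rw [Finset.sum_range_succ' _ (N + 1)]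
    have : ∀ i, i + (j + 1) = i + 1 + j := fun i => by omega
    simp [this]
  rw [e]
  exact (norm_sub_le _ _).trans
    (add_le_add (key (N + 2) (by omega) j) (key (N + 1) (by omega) (j + 1)))
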